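/- Let X ~ χ²_n with n ≥ 1 and Y_n = (ln X − ln n)/sqrt(2/n). Then the total variation distance between the law of Y_n and the standard normal distribution is O(1/√n); that is, there exist constants C and N₀ such that for any n ≥ N₀, ∫_{-∞}^{∞} |f_{Y_n}(y) − φ(y)| dy ≤ C/√n, where φ is the standard normal density. -/

import Mathlib

open MeasureTheory Real

/-- The Gamma integral after the substitution `u = exp x`. -/
theorem integral_exp_mul_sub_exp {a : ℝ} (ha : 0 < a) :
    ∫ x : ℝ, exp (a * x - exp x) = Gamma a := by
  have h := integral_image_eq_integral_abs_deriv_smul (s := Set.univ) (f := exp) (f' := exp)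
    MeasurableSet.univ (fun x _ => (hasDerivAt_exp x).hasDerivWithinAt) exp_injective.injOn
    (fun u => exp (-u) * u ^ (a - 1))
  rw [Set.image_univ, range_exp, ← Gamma_eq_integral ha, setIntegral_univ] at h
  rw [h]
  refine integral_congr_ae (.of_forall fun x => ?_)
  simp only [abs_exp, smul_eq_mul]
  rw [← exp_mul, ← exp_add, ← exp_add]
  ring_nf

theorem integral_exp_div_sub_mul_exp {a t : ℝ} (ha : 0 < a) (ht : 0 < t) (hat : a * t ^ 2 = 1) :
    ∫ y : ℝ, exp (y / t - a * exp (t * y)) = a ^ (1 / 2 - a) * Gamma a := by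
  have hta : t⁻¹ = a ^ (1 / 2 : ℝ) := by
    rw [← sqrt_eq_rpow, eq_comm, sqrt_eq_iff_mul_self_eq ha.le (by positivity)]
    field_simp
    linarith
  have h := Measure.integral_comp_mul_left
    (fun x => exp (a * (x + log a) - exp (x + log a))) t
  rw [integral_add_right_eq_self (fun x => exp (a * x - exp x)),
    integral_exp_mul_sub_exp ha, abs_of_pos (by positivity), smul_eq_mul, hta] at h
  rw [rpow_sub ha, div_mul_eq_mul_div, ← h, eq_div_iff (by positivity), ← integral_mul_const]
  refine integral_congr_ae (.of_forall fun y => ?_)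
  simp only
  rw [exp_add, exp_log ha, rpow_def_of_pos ha, ← exp_add]
  congr 1
  have : y / t = a * t * y := by field_simp; linear_combination -y * hat
  rw [this]
  ring

theorem abs_exp_neg_sub_exp_neg_le {p q m : ℝ} (hp : m ≤ p) (hq : m ≤ q) :
    |exp (-p) - exp (-q)| ≤ exp (-m) * min 1 |p - q| := by
  wlog h : p ≤ q generalizing p q
  · rw [abs_sub_comm, abs_sub_comm p]
    exact this hq hp (le_of_not_ge h)
  have e : exp (-p) - exp (-q) = exp (-p) * (1 - exp (p - q)) := by
    rw [mul_sub, ← exp_add]; ring_nf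
  have h1 : exp (p - q) ≤ 1 := exp_le_one_iff.2 (by linarith)
  rw [e, abs_of_nonneg (mul_nonneg (exp_nonneg _) (by linarith))]
  refine mul_le_mul (exp_le_exp.2 (by linarith)) (le_min ?_ ?_) (by linarith) (exp_nonneg _)
  · linarith [exp_pos (p - q)]
  · rw [abs_of_nonpos (by linarith)]
    linarith [add_one_le_exp (p - q)]

theorem abs_exp_sub_quadratic_le {z : ℝ} (hz : |z| ≤ 1) :
    |exp z - 1 - z - z ^ 2 / 2| ≤ 2 / 9 * |z| ^ 3 := by
  have h := exp_bound hz (n := 3) (by norm_num)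
  norm_num [Finset.sum_range_succ, Nat.factorial] at h
  rw [show exp z - 1 - z - z ^ 2 / 2 = exp z - (1 + z + z ^ 2 / 2) by ring]
  linarith

theorem abs_div_three_le_exp_sub {z : ℝ} (hz : 1 < |z|) : |z| / 3 ≤ exp z - 1 - z := by
  rcases lt_abs.1 hz with h | h
  · rw [abs_of_pos (by linarith)]
    nlinarith [quadratic_le_exp_of_nonneg (show 0 ≤ z by linarith)]
  · rw [abs_of_neg (by linarith)]
    rcases le_total z (-2) with h2 | h2
    · linarith [exp_pos z]
    · have h1 : exp z = exp (-1) * exp (z + 1) := by rw [← exp_add]; ring_nf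
      have h3 : 1 / 3 ≤ exp (-1) := by
        rw [exp_neg, ← one_div]
        exact one_div_le_one_div_of_le (exp_pos 1) (by linarith [exp_one_lt_d9])
      have h4 : 1 / 3 * (z + 2) ≤ exp z := by
        rw [h1]
        exact mul_le_mul h3 (by linarith [add_one_le_exp (z + 1)]) (by linarith) (exp_nonneg _)
      linarith

theorem abs_div_three_sub_one_le_exp_sub_div {t y : ℝ} (ht : 0 < t) (ht1 : t ≤ 1) :
    |y| / 3 - 1 ≤ (exp (t * y) - 1 - t * y) / t ^ 2 := by
  rw [le_div_iff₀ (by positivity)]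
  have habs : |t * y| = t * |y| := by rw [abs_mul, abs_of_pos ht]
  rcases le_or_gt |t * y| 1 with h | h
  · have h1 := (abs_le.1 (abs_exp_sub_quadratic_le h)).1
    have h2 : |t * y| ^ 3 ≤ |t * y| ^ 2 := pow_le_pow_of_le_one (abs_nonneg _) h (by norm_num)
    rw [sq_abs] at h2
    have h3 : 0 ≤ t ^ 2 * (5 * |y| ^ 2 - 6 * |y| + 18) := by
      refine mul_nonneg (sq_nonneg _) ?_
      nlinarith [sq_nonneg (|y| - 1)]
    rw [sq_abs] at h3
    nlinarith
  · have h1 := abs_div_three_le_exp_sub h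
    rw [habs] at h1
    have : t ^ 2 * |y| ≤ t * |y| := by
      refine mul_le_mul_of_nonneg_right ?_ (abs_nonneg _)
      nlinarith
    nlinarith [sq_nonneg t]

theorem abs_exp_neg_sub_gaussian_le {t : ℝ} (ht : 0 < t) (ht1 : t ≤ 1) (y : ℝ) :
    |exp (-((exp (t * y) - 1 - t * y) / t ^ 2)) - exp (-y ^ 2 / 2)|
      ≤ t * ((|y| + |y| ^ 3) * exp (1 - |y| / 3)) := by
  have hq : |y| / 3 - 1 ≤ y ^ 2 / 2 := by
    rw [← sq_abs]; nlinarith [sq_nonneg (|y| - 1)]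
  have habs : |t * y| = t * |y| := by rw [abs_mul, abs_of_pos ht]
  have key := abs_exp_neg_sub_exp_neg_le (abs_div_three_sub_one_le_exp_sub_div (y := y) ht ht1) hq
  rw [neg_div, show 1 - |y| / 3 = -(|y| / 3 - 1) by ring]
  refine key.trans ?_
  rw [mul_comm (exp _), ← mul_assoc]
  refine mul_le_mul_of_nonneg_right ?_ (exp_nonneg _)
  have hy := abs_nonneg y
  rcases le_or_gt |t * y| 1 with h | h
  · refine (min_le_right _ _).trans ?_
    have h1 := abs_exp_sub_quadratic_le h
    rw [show (exp (t * y) - 1 - t * y) / t ^ 2 - y ^ 2 / 2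
      = (exp (t * y) - 1 - t * y - (t * y) ^ 2 / 2) / t ^ 2 by field_simp, abs_div,
      abs_of_pos (show 0 < t ^ 2 by positivity), div_le_iff₀ (by positivity)]
    refine h1.trans ?_
    rw [habs]
    have : 0 ≤ t ^ 3 * |y| := by positivity
    have : 0 ≤ t ^ 3 * |y| ^ 3 := by positivity
    nlinarith
  · refine (min_le_left _ _).trans ?_
    rw [habs] at h
    have : 0 ≤ t * |y| ^ 3 := by positivity
    nlinarith

theorem abs_add_abs_pow_three_mul_exp_le (y : ℝ) :
    (|y| + |y| ^ 3) * exp (1 - |y| / 3) ≤ 30000 * exp 1 * (1 + y ^ 2)⁻¹ := by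
  rw [sub_eq_add_neg, exp_add, exp_neg, ← sq_abs y]
  set x := |y|
  have hx : 0 ≤ x / 3 := by positivity
  have h1 := pow_div_factorial_le_exp _ hx 1
  have h3 := pow_div_factorial_le_exp _ hx 3
  have h5 := pow_div_factorial_le_exp _ hx 5
  norm_num [Nat.factorial] at h1 h3 h5
  have h : (x + x ^ 3) * (1 + x ^ 2) ≤ 30000 * exp (x / 3) := by
    nlinarith [exp_pos (x / 3)]
  calc (x + x ^ 3) * (exp 1 * (exp (x / 3))⁻¹)
      = exp 1 * ((x + x ^ 3) * (1 + x ^ 2)) * (exp (x / 3))⁻¹ * (1 + x ^ 2)⁻¹ := by field_simp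
    _ ≤ exp 1 * (30000 * exp (x / 3)) * (exp (x / 3))⁻¹ * (1 + x ^ 2)⁻¹ := by gcongr
    _ = 30000 * exp 1 * (1 + x ^ 2)⁻¹ := by field_simp

theorem exists_integral_abs_exp_neg_sub_gaussian_le :
    ∃ C : ℝ, 0 ≤ C ∧ ∀ t : ℝ, 0 < t → t ≤ 1 →
      Integrable (fun y : ℝ => exp (-((exp (t * y) - 1 - t * y) / t ^ 2)) - exp (-y ^ 2 / 2)) ∧
      ∫ y : ℝ, |exp (-((exp (t * y) - 1 - t * y) / t ^ 2)) - exp (-y ^ 2 / 2)| ≤ C * t := by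
  refine ⟨30000 * exp 1 * π, by positivity, fun t ht ht1 => ?_⟩
  have hi : Integrable (fun y : ℝ => t * (30000 * exp 1 * (1 + y ^ 2)⁻¹)) :=
    (integrable_inv_one_add_sq.const_mul _).const_mul _
  have hb (y : ℝ) : |exp (-((exp (t * y) - 1 - t * y) / t ^ 2)) - exp (-y ^ 2 / 2)|
      ≤ t * (30000 * exp 1 * (1 + y ^ 2)⁻¹) :=
    (abs_exp_neg_sub_gaussian_le ht ht1 y).trans
      (mul_le_mul_of_nonneg_left (abs_add_abs_pow_three_mul_exp_le y) ht.le)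
  have hI := hi.mono' (f := fun y : ℝ =>
      exp (-((exp (t * y) - 1 - t * y) / t ^ 2)) - exp (-y ^ 2 / 2))
    (by fun_prop) (.of_forall hb)
  refine ⟨hI, (integral_mono hI.abs hi hb).trans_eq ?_⟩
  rw [integral_const_mul, integral_const_mul, integral_univ_inv_one_add_sq]
  ring

/-- If `g` is close to `h` in `L¹`, then so are the normalized functions. -/
theorem integral_abs_normalize_sub_le {g h : ℝ → ℝ} (hg : Integrable g) (hh : Integrable h)
    {A B δ : ℝ} (hA : A * ∫ y, g y = 1) (hB : B * ∫ y, h y = 1) (hA0 : 0 ≤ A)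
    (hh0 : ∀ y, 0 ≤ h y) (hδ : ∫ y, |g y - h y| ≤ δ) :
    ∫ y, |A * g y - B * h y| ≤ 2 * A * δ := by
  have hgh : Integrable fun y => |g y - h y| := (hg.sub hh).abs
  have hmass : |A - B| * ∫ y, h y ≤ A * δ := by
    have hpos : 0 ≤ ∫ y, h y := integral_nonneg hh0
    calc |A - B| * ∫ y, h y = |(A - B) * ∫ y, h y| := by rw [abs_mul, abs_of_nonneg hpos]
      _ = |A * ∫ y, (g y - h y)| := by
        rw [integral_sub hg hh, mul_sub, hA, sub_mul, hB, abs_sub_comm]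
      _ = A * |∫ y, (g y - h y)| := by rw [abs_mul, abs_of_nonneg hA0]
      _ ≤ A * δ := mul_le_mul_of_nonneg_left (abs_integral_le_integral_abs.trans hδ) hA0
  calc ∫ y, |A * g y - B * h y| ≤ ∫ y, (A * |g y - h y| + |A - B| * h y) := by
        refine integral_mono ((hg.const_mul A).sub (hh.const_mul B)).abs
          ((hgh.const_mul A).add (hh.const_mul _)) fun y => ?_
        calc |A * g y - B * h y| = |A * (g y - h y) + (A - B) * h y| := by congr 1; ring
          _ ≤ _ := abs_add_le _ _
          _ = _ := by rw [abs_mul, abs_mul, abs_of_nonneg hA0, abs_of_nonneg (hh0 y)]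
    _ = A * (∫ y, |g y - h y|) + |A - B| * ∫ y, h y := by
        rw [integral_add (hgh.const_mul A) (hh.const_mul _), integral_const_mul,
          integral_const_mul]
    _ ≤ A * δ + A * δ := add_le_add (mul_le_mul_of_nonneg_left hδ hA0) hmass
    _ = 2 * A * δ := by ring

/-- Total variation bound: the density of the standardized log of a chi-squared
random variable is within `O(1/√n)` of the standard normal density in `L¹`. -/
theorem stmt2 : ∃ (C : ℝ) (N₀ : ℕ), ∀ n : ℕ, N₀ ≤ n →
    ∫ y : ℝ, |((n : ℝ) / 2) ^ (((n : ℝ) - 1) / 2) / Real.Gamma ((n : ℝ) / 2)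
        * Real.exp (Real.sqrt ((n : ℝ) / 2) * y
            - (n : ℝ) / 2 * Real.exp (Real.sqrt (2 / (n : ℝ)) * y))
      - (1 / Real.sqrt (2 * π)) * Real.exp (-y ^ 2 / 2)|
      ≤ C / Real.sqrt n := by
  obtain ⟨C, hC, hCt⟩ := exists_integral_abs_exp_neg_sub_gaussian_le
  refine ⟨2 * C * √2, max 2 ⌈2 * C ^ 2⌉₊, fun n hn => ?_⟩
  have hn2 : (2 : ℝ) ≤ n := by exact_mod_cast (le_max_left _ _).trans hn
  have hnC : 2 * C ^ 2 ≤ n := (Nat.le_ceil _).trans (by exact_mod_cast (le_max_right _ _).trans hn)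
  have hn0 : (0 : ℝ) < n := by linarith
  set a : ℝ := n / 2 with ha_def
  set t : ℝ := √(2 / n) with ht_def
  have ha : 0 < a := by positivity
  have ht : 0 < t := by positivity
  have ht2 : t ^ 2 = 2 / n := sq_sqrt (by positivity)
  have hat : a * t ^ 2 = 1 := by rw [ht2, ha_def]; field_simp
  have ht1 : t ≤ 1 := sqrt_le_one.2 (by rw [div_le_one hn0]; exact hn2)
  have hsa : √a = t⁻¹ := by rw [ht_def, ← sqrt_inv, inv_div]
  have hCt1 : C * t ≤ 1 := by
    rw [← abs_of_nonneg (mul_nonneg hC ht.le), ← sq_le_one_iff_abs_le_one, mul_pow, ht2,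
      mul_div_assoc', div_le_one hn0]
    linarith
  obtain ⟨hI, hbound⟩ := hCt t ht ht1
  set g : ℝ → ℝ := fun y => exp (-((exp (t * y) - 1 - t * y) / t ^ 2)) with hg_def
  have hφ : Integrable (fun y : ℝ => exp (-y ^ 2 / 2)) := by
    simpa [neg_div, div_eq_inv_mul] using integrable_exp_neg_mul_sq (b := 2⁻¹) (by norm_num)
  have hφint : ∫ y : ℝ, exp (-y ^ 2 / 2) = √(2 * π) := by
    have := integral_gaussian 2⁻¹
    simpa [neg_div, div_eq_inv_mul, mul_comm] using this
  have hg : Integrable g := (hI.add hφ).congr (.of_forall fun y => sub_add_cancel _ _)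
  set K : ℝ := a ^ (((n : ℝ) - 1) / 2) / Gamma a with hK
  have hΓ := Gamma_pos_of_pos ha
  have hfac (y : ℝ) : exp (√a * y - a * exp (t * y)) = exp (-a) * g y := by
    rw [hg_def, ← exp_add, hsa, eq_div_of_mul_eq (by positivity) hat]
    congr 1
    field_simp
    ring
  have hA : K * exp (-a) * ∫ y, g y = 1 := by
    rw [mul_assoc, ← integral_const_mul]
    simp_rw [← hfac, hsa, inv_mul_eq_div]
    rw [integral_exp_div_sub_mul_exp ha ht hat, hK, div_mul_eq_mul_div, ← mul_assoc,
      ← rpow_add ha, mul_div_cancel_right₀ _ hΓ.ne',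
      show ((n : ℝ) - 1) / 2 + (1 / 2 - a) = 0 by rw [ha_def]; ring, rpow_zero]
  have hB : 1 / √(2 * π) * ∫ y : ℝ, exp (-y ^ 2 / 2) = 1 := by
    rw [hφint]
    exact one_div_mul_cancel (by positivity)
  have hA0 : 0 ≤ K * exp (-a) := by positivity
  have hg1 : 1 ≤ ∫ y, g y := by
    have h := (abs_le.1 (abs_integral_le_integral_abs.trans (hbound.trans hCt1))).1
    rw [integral_sub hg hφ, hφint] at h
    have : 2 ≤ √(2 * π) := le_sqrt_of_sq_le (by linarith [pi_gt_three])
    linarith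
  have hA1 : K * exp (-a) ≤ 1 := by nlinarith
  simp_rw [hfac, ← mul_assoc]
  refine (integral_abs_normalize_sub_le hg hφ hA hB hA0 (fun y => exp_nonneg _) hbound).trans ?_
  calc 2 * (K * exp (-a)) * (C * t) ≤ 2 * 1 * (C * t) := by gcongr
    _ = 2 * C * √2 / √n := by rw [ht_def, sqrt_div (by norm_num)]; ring
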